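/- arXiv:math-ph/0612027 — 2 statements merged into one kernel-verified Lean document; each statement's English description precedes it below -/
import Mathlib

section
/- There exists a constant C > 0 such that for all integers n ≥ 1 and all integers k with 1 ≤ k ≤ n, setting α = j_{n+1,k} and β = j_{n,k}, one has |J_{n+1}(αx)| ≤ C · n · (1 − x) · |J_n(α)| for every real x with β/α < x < 1. -/
open Real MeasureTheory intervalIntegral

/-- The Bessel function of the first kind of (integer) order `n`, defined by its
everywhere-convergent power series. -/
noncomputable def besselJ (n : ℕ) (x : ℝ) : ℝ :=
  ∑' m : ℕ, ((-1 : ℝ) ^ m / (Nat.factorial m * Nat.factorial (m + n))) * (x / 2) ^ (2 * m + n)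

/-- `x` is the `k`-th positive zero of `f` (for `k ≥ 1`): `x` is a positive zero of `f`
and there are exactly `k - 1` positive zeros of `f` below `x`. -/
def IsKthPosZero (f : ℝ → ℝ) (k : ℕ) (x : ℝ) : Prop :=
  0 < x ∧ f x = 0 ∧ {y : ℝ | 0 < y ∧ y < x ∧ f y = 0}.ncard = k - 1
/-- Coefficients of the entire function `E_n`. -/
noncomputable def bc (n m : ℕ) : ℝ := (-1 : ℝ) ^ m / (Nat.factorial m * Nat.factorial (m + n))

/-- The entire function with `J_n(x) = (x/2)^n E_n(x^2/4)`. -/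
noncomputable def bE (n : ℕ) (u : ℝ) : ℝ := ∑' m : ℕ, bc n m * u ^ m

lemma bc_abs_le (n m : ℕ) : |bc n m| ≤ 1 / (Nat.factorial m : ℝ) := by
  unfold bc
  rw [abs_div, abs_pow, abs_neg, abs_one, one_pow, abs_of_pos (by positivity)]
  apply one_div_le_one_div_of_le (by positivity)
  have : (1 : ℝ) ≤ Nat.factorial (m + n) := by exact_mod_cast Nat.factorial_pos _
  have h2 : (0 : ℝ) < Nat.factorial m := by positivity
  nlinarith

lemma bc_succ (n m : ℕ) : bc n (m + 1) * ((m : ℝ) + 1) = - bc (n + 1) m := by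
  unfold bc
  rw [show m + 1 + n = m + (n + 1) by ring, Nat.factorial_succ m]
  push_cast
  field_simp
  ring

lemma bE_summable (n : ℕ) (u : ℝ) : Summable (fun m => bc n m * u ^ m) := by
  apply Summable.of_norm_bounded (Real.summable_pow_div_factorial |u|)
  intro m
  rw [Real.norm_eq_abs, abs_mul, abs_pow]
  have := mul_le_mul_of_nonneg_right (bc_abs_le n m) (pow_nonneg (abs_nonneg u) m)
  calc _ ≤ _ := this
    _ = _ := by ring

lemma bE_hasDerivAt (n : ℕ) (u : ℝ) : HasDerivAt (bE n) (- bE (n + 1) u) u := by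
  have hE : bE n = fun u => bc n 0 + ∑' m : ℕ, bc n (m + 1) * u ^ (m + 1) := by
    funext v
    unfold bE
    rw [(bE_summable n v).tsum_eq_zero_add]
    simp
  rw [hE]
  have key := hasDerivAt_tsum_of_isPreconnected (𝕜 := ℝ) (F := ℝ)
    (g := fun m u => bc n (m + 1) * u ^ (m + 1))
    (g' := fun m u => - (bc (n + 1) m * u ^ m))
    (u := fun m => (|u| + 1) ^ m / (Nat.factorial m : ℝ))
    (t := Metric.ball 0 (|u| + 1)) (y₀ := u) (y := u)
    (Real.summable_pow_div_factorial (|u| + 1)) Metric.isOpen_ball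
    (convex_ball _ _).isPreconnected ?_ ?_ ?_ ?_ ?_
  · have h2 : (∑' m, - (bc (n + 1) m * u ^ m)) = - bE (n + 1) u := by
      rw [tsum_neg]; rfl
    rw [h2] at key
    simpa using key.const_add (bc n 0)
  · intro m y _
    have := (hasDerivAt_pow (m + 1) y).const_mul (bc n (m + 1))
    refine this.congr_deriv ?_
    rw [← neg_mul, ← bc_succ]
    push_cast
    ring
  · intro m y hy
    rw [norm_neg, Real.norm_eq_abs, abs_mul, abs_pow]
    have hy' : |y| ≤ |u| + 1 := by
      have := mem_ball_zero_iff.1 hy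
      rw [Real.norm_eq_abs] at this
      exact this.le
    calc |bc (n + 1) m| * |y| ^ m ≤ 1 / (Nat.factorial m : ℝ) * (|u| + 1) ^ m := by
          gcongr
          exact bc_abs_le _ _
      _ = _ := by ring
  · simp
  · exact (summable_nat_add_iff 1).2 (bE_summable n u)
  · simp

lemma bE_term (n m : ℕ) (u : ℝ) :
    ((m + 1 : ℕ) : ℝ) * (bc (n + 1) (m + 1) * u ^ (m + 1)) = (-u) * (bc (n + 2) m * u ^ m) := by
  have h := bc_succ (n + 1) m
  push_cast
  have h' : bc (n + 1 + 1) m = bc (n + 2) m := rfl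
  rw [h'] at h
  rw [pow_succ]
  linear_combination (u ^ m * u) * h

lemma bc_rec (n m : ℕ) : bc n m = (n + 1 + m) * bc (n + 1) m := by
  unfold bc
  rw [show m + (n + 1) = (m + n) + 1 by ring, Nat.factorial_succ (m + n)]
  push_cast
  have : (m : ℝ) + n + 1 ≠ 0 := by positivity
  field_simp
  ring

lemma bE_rec (n : ℕ) (u : ℝ) : bE n u = (n + 1) * bE (n + 1) u - u * bE (n + 2) u := by
  have hs : Summable (fun m : ℕ => ((m + 1 : ℕ) : ℝ) * (bc (n + 1) (m + 1) * u ^ (m + 1))) := by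
    simp_rw [bE_term]
    exact (bE_summable (n + 2) u).mul_left (-u)
  have hs2 : Summable (fun m : ℕ => (m : ℝ) * (bc (n + 1) m * u ^ m)) :=
    (summable_nat_add_iff (f := fun m : ℕ => (m : ℝ) * (bc (n + 1) m * u ^ m)) 1).1 hs
  have h1 : ∑' m : ℕ, (m : ℝ) * (bc (n + 1) m * u ^ m) = - (u * bE (n + 2) u) := by
    rw [hs2.tsum_eq_zero_add]
    simp_rw [bE_term]
    rw [tsum_mul_left]
    unfold bE
    simp
  have h2 : bE n u = ∑' m : ℕ, (((n : ℝ) + 1) * (bc (n + 1) m * u ^ m) +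
      (m : ℝ) * (bc (n + 1) m * u ^ m)) := by
    unfold bE
    apply tsum_congr
    intro m
    rw [bc_rec]
    ring
  rw [h2, ((bE_summable (n + 1) u).mul_left _).tsum_add hs2, h1, tsum_mul_left]
  unfold bE
  ring

lemma bJ_eq (n : ℕ) (x : ℝ) : besselJ n x = (x / 2) ^ n * bE n ((x / 2) ^ 2) := by
  unfold besselJ bE
  rw [← tsum_mul_left]
  congr 1
  funext m
  rw [← pow_mul, pow_add]
  unfold bc
  ring

lemma bJ_eq' (n : ℕ) : besselJ n = fun x => (x / 2) ^ n * bE n ((x / 2) ^ 2) :=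
  funext (bJ_eq n)

lemma bJ_rec (n : ℕ) {x : ℝ} (hx : 0 < x) :
    besselJ n x + besselJ (n + 2) x = 2 * (n + 1) / x * besselJ (n + 1) x := by
  rw [bJ_eq, bJ_eq, bJ_eq, bE_rec n ((x / 2) ^ 2)]
  field_simp
  ring

lemma bE_comp_deriv (n : ℕ) (x : ℝ) :
    HasDerivAt (fun x => bE n ((x / 2) ^ 2)) (- (x / 2) * bE (n + 1) ((x / 2) ^ 2)) x := by
  have h1 : HasDerivAt (fun x : ℝ => (x / 2) ^ 2) (x / 2) x := by
    have := ((hasDerivAt_id' x).div_const 2).fun_pow 2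
    refine this.congr_deriv ?_
    norm_num
    ring
  have := (bE_hasDerivAt n ((x / 2) ^ 2)).comp x h1
  refine this.congr_deriv ?_
  ring

lemma bJ_deriv (n : ℕ) {x : ℝ} (hx : 0 < x) :
    HasDerivAt (besselJ n) (n / x * besselJ n x - besselJ (n + 1) x) x := by
  have h1 : HasDerivAt (fun x : ℝ => (x / 2) ^ n) (n / x * (x / 2) ^ n) x := by
    have := ((hasDerivAt_id' x).div_const 2).fun_pow n
    refine this.congr_deriv ?_
    rcases n with _ | n
    · simp
    · simp
      field_simp
      ring
  have := h1.mul (bE_comp_deriv n x)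
  rw [bJ_eq, bJ_eq, bJ_eq' n]
  refine this.congr_deriv ?_
  ring

lemma bJ_deriv_succ (n : ℕ) {x : ℝ} (hx : 0 < x) :
    HasDerivAt (besselJ (n + 1)) (besselJ n x - (n + 1) / x * besselJ (n + 1) x) x := by
  have := bJ_deriv (n + 1) hx
  refine this.congr_deriv ?_
  have h := bJ_rec n hx
  push_cast
  have : besselJ (n + 1 + 1) x = besselJ (n + 2) x := rfl
  rw [this]
  linear_combination -h

lemma bE_continuous (n : ℕ) : Continuous (bE n) :=
  continuous_iff_continuousAt.2 fun u => (bE_hasDerivAt n u).continuousAt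

lemma bJ_continuous (n : ℕ) : Continuous (besselJ n) := by
  rw [bJ_eq']
  have := bE_continuous n
  fun_prop

lemma bJ_pos_near (n : ℕ) : ∃ ε > 0, ∀ x, 0 < x → x < ε → 0 < besselJ n x := by
  have h0 : 0 < bE n (((0:ℝ) / 2) ^ 2) := by
    have : bE n (((0:ℝ) / 2) ^ 2) = bc n 0 := by
      unfold bE
      rw [tsum_eq_single 0]
      · simp
      · intro m hm; simp [hm]
    rw [this]; unfold bc; positivity
  have hc : Continuous (fun x : ℝ => bE n ((x / 2) ^ 2)) := by
    have := bE_continuous n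
    fun_prop
  have := hc.continuousAt.eventually (lt_mem_nhds h0)
  obtain ⟨ε, hε, h⟩ := Metric.eventually_nhds_iff.1 this
  refine ⟨ε, hε, fun x hx hxe => ?_⟩
  rw [bJ_eq]
  have := h (y := x) (by rw [Real.dist_eq, sub_zero, abs_of_pos hx]; exact hxe)
  positivity

lemma bJ_zero (n : ℕ) (hn : 1 ≤ n) : besselJ n 0 = 0 := by
  rw [bJ_eq]
  have : n ≠ 0 := by omega
  simp [this]

lemma same_sign {f : ℝ → ℝ} {a b : ℝ} (hf : Continuous f)
    (h : ∀ x ∈ Set.Icc a b, f x ≠ 0) {x y : ℝ} (hx : x ∈ Set.Icc a b) (hy : y ∈ Set.Icc a b) :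
    0 < f x * f y := by
  by_contra hneg
  push Not at hneg
  have hsub : Set.uIcc x y ⊆ Set.Icc a b := Set.uIcc_subset_Icc hx hy
  have h0 : (0 : ℝ) ∈ Set.uIcc (f x) (f y) := by
    rw [Set.mem_uIcc]
    rcases mul_nonpos_iff.1 hneg with ⟨h1, h2⟩ | ⟨h1, h2⟩
    · right; exact ⟨h2, h1⟩
    · left; exact ⟨h1, h2⟩
  obtain ⟨z, hz, hz0⟩ := intermediate_value_uIcc (f := f) (a := x) (b := y) hf.continuousOn h0
  exact h z (hsub hz) hz0

/-- `J_n` is positive on `(0, n]`. -/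
lemma bJ_pos (n : ℕ) (hn : 1 ≤ n) {x : ℝ} (hx : 0 < x) (hxn : x ≤ n) : 0 < besselJ n x := by
  by_contra hneg
  push Not at hneg
  obtain ⟨ε, hε, hpos⟩ := bJ_pos_near n
  -- first zero
  let S : Set ℝ := {y | y ∈ Set.Icc (min (ε / 2) x) x ∧ besselJ n y ≤ 0}
  have hSc : IsCompact S := by
    have : S = Set.Icc (min (ε / 2) x) x ∩ {y | besselJ n y ≤ 0} := rfl
    rw [this]
    exact isCompact_Icc.inter_right (isClosed_le (bJ_continuous n) continuous_const)
  have hne : S.Nonempty := ⟨x, ⟨min_le_right _ _, le_rfl⟩, hneg⟩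
  obtain ⟨z, hzS, hzmin⟩ := hSc.exists_isLeast hne
  have hm0 : 0 < min (ε / 2) x := lt_min (by linarith) hx
  have hz0 : 0 < z := lt_of_lt_of_le hm0 hzS.1.1
  have hzn : z ≤ n := hzS.1.2.trans hxn
  have hlt : ∀ y, 0 < y → y < z → 0 < besselJ n y := by
    intro y hy hyz
    by_contra hcon
    push Not at hcon
    rcases lt_or_ge y (min (ε / 2) x) with h | h
    · have := hpos y hy (by have := min_le_left (ε / 2) x; linarith)
      linarith
    · have : z ≤ y := hzmin ⟨⟨h, hyz.le.trans hzS.1.2⟩, hcon⟩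
      linarith
  let H : ℝ → ℝ := fun t => n * besselJ n t - t * besselJ (n + 1) t
  have hH : ∀ t, 0 < t → HasDerivAt H ((n ^ 2 / t - t) * besselJ n t) t := by
    intro t ht
    have := ((bJ_deriv n ht).const_mul (n : ℝ)).fun_sub ((hasDerivAt_id' t).fun_mul (bJ_deriv_succ n ht))
    refine this.congr_deriv ?_
    field_simp
    ring
  have hHc : Continuous H := by
    have := bJ_continuous n
    have := bJ_continuous (n + 1)
    fun_prop
  have hHmono : StrictMonoOn H (Set.Icc 0 z) := by
    apply strictMonoOn_of_deriv_pos (convex_Icc _ _) hHc.continuousOn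
    intro t ht
    rw [interior_Icc] at ht
    rw [(hH t ht.1).deriv]
    apply mul_pos _ (hlt t ht.1 ht.2)
    rw [sub_pos, lt_div_iff₀ ht.1]
    have := ht.1
    have := ht.2
    nlinarith
  have hH0 : H 0 = 0 := by simp [H, bJ_zero n hn]
  have hJmono : StrictMonoOn (besselJ n) (Set.Icc 0 z) := by
    apply strictMonoOn_of_deriv_pos (convex_Icc _ _) (bJ_continuous n).continuousOn
    intro t ht
    rw [interior_Icc] at ht
    rw [(bJ_deriv n ht.1).deriv]
    have h1 := hHmono ⟨le_rfl, hz0.le⟩ ⟨ht.1.le, ht.2.le⟩ ht.1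
    rw [hH0] at h1
    have h2 : (n / t * besselJ n t - besselJ (n + 1) t) = H t / t := by
      simp only [H]
      have := ht.1
      field_simp
    rw [h2]
    exact div_pos h1 ht.1
  have := hJmono ⟨le_rfl, hz0.le⟩ ⟨hz0.le, le_rfl⟩ hz0
  rw [bJ_zero n hn] at this
  have h3 := hzS.2
  linarith

lemma bJ_no_common (n : ℕ) {x : ℝ} (hx : 0 < x) (h0 : besselJ n x = 0)
    (h1 : besselJ (n + 1) x = 0) : False := by
  have hall : ∀ m, besselJ (n + m) x = 0 ∧ besselJ (n + m + 1) x = 0 := by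
    intro m
    induction m with
    | zero => exact ⟨h0, h1⟩
    | succ m ih =>
      refine ⟨ih.2, ?_⟩
      have := bJ_rec (n + m) hx
      rw [ih.1, ih.2] at this
      have h' : besselJ (n + (m + 1) + 1) x = besselJ (n + m + 2) x := rfl
      rw [h']
      linarith
  obtain ⟨m, hm⟩ := exists_nat_gt x
  have := bJ_pos (n + (m + 1)) (by omega) hx (by push_cast; have : (0:ℝ) ≤ n := by positivity
                                                 linarith)
  rw [(hall (m + 1)).1] at this
  exact lt_irrefl _ this

lemma bJ_finite (n : ℕ) (a : ℝ) : {y : ℝ | 0 < y ∧ y < a ∧ besselJ n y = 0}.Finite := by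
  by_contra hinf
  have hinf : {y : ℝ | 0 < y ∧ y < a ∧ besselJ n y = 0}.Infinite := hinf
  obtain ⟨p, hp, hacc⟩ := hinf.exists_accPt_of_subset_isCompact (K := Set.Icc 0 a)
    isCompact_Icc (fun y hy => ⟨hy.1.le, hy.2.1.le⟩)
  rw [accPt_iff_frequently_nhdsNE] at hacc
  rcases hp.1.lt_or_eq with hp0 | hp0
  · have hfz : besselJ n p = 0 := by
      by_contra hne
      have : ∀ᶠ y in nhds p, besselJ n y ≠ 0 :=
        (bJ_continuous n).continuousAt.eventually_ne hne
      exact hacc ((this.filter_mono nhdsWithin_le_nhds).mono fun y hy hy2 => hy hy2.2.2)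
    have hd : besselJ (n + 1) p = 0 := by
      by_contra hne
      have hD := bJ_deriv n hp0
      have := hD.eventually_ne (c := 0) (by rw [hfz]; simpa using hne)
      exact hacc (this.mono fun y hy hy2 => hy hy2.2.2)
    exact bJ_no_common n hp0 hfz hd
  · obtain ⟨ε, hε, hpos⟩ := bJ_pos_near n
    have : ∀ᶠ y in nhds p, y < ε := by
      rw [← hp0]; exact gt_mem_nhds hε
    exact hacc ((this.filter_mono nhdsWithin_le_nhds).mono fun y hy hy2 =>
      (hpos y hy2.1 hy).ne' hy2.2.2)

/-- Between two zeros of `J_n` there is a zero of `J_{n+1}`. -/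
lemma bJ_rolle (n : ℕ) {a b : ℝ} (ha : 0 < a) (hab : a < b) (h1 : besselJ n a = 0)
    (h2 : besselJ n b = 0) : ∃ c ∈ Set.Ioo a b, besselJ (n + 1) c = 0 := by
  have hE : ∀ x, 0 < x → besselJ n x = 0 → bE n ((x / 2) ^ 2) = 0 := by
    intro x hx h
    rw [bJ_eq] at h
    rcases mul_eq_zero.1 h with h | h
    · have : 0 < (x / 2) ^ n := by positivity
      linarith
    · exact h
  obtain ⟨c, hc, h⟩ := exists_hasDerivAt_eq_zero (f := fun x => bE n ((x / 2) ^ 2)) hab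
    (fun x _ => (bE_comp_deriv n x).continuousAt.continuousWithinAt)
    ((hE a ha h1).trans (hE b (ha.trans hab) h2).symm) (fun x _ => bE_comp_deriv n x)
  refine ⟨c, hc, ?_⟩
  have hc0 : 0 < c := ha.trans hc.1
  rcases mul_eq_zero.1 h with h | h
  · linarith
  · rw [bJ_eq, h, mul_zero]

lemma bJ_count (n : ℕ) (S : Finset ℝ) : ∀ b : ℝ, (∀ y ∈ S, 0 < y ∧ y < b ∧ besselJ n y = 0) →
    besselJ n b = 0 → ∃ T : Finset ℝ, T.card = S.card ∧
      ∀ y ∈ T, 0 < y ∧ y < b ∧ besselJ (n + 1) y = 0 := by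
  induction S using Finset.induction_on_max with
  | empty => intro b _ _; exact ⟨∅, by simp⟩
  | insert a S hmax ih =>
    intro b hS hb
    have ha := hS a (Finset.mem_insert_self _ _)
    obtain ⟨T, hT, hT2⟩ := ih a (fun y hy => by
      have := hS y (Finset.mem_insert_of_mem hy)
      exact ⟨this.1, hmax y hy, this.2.2⟩) ha.2.2
    obtain ⟨c, hc, hc0⟩ := bJ_rolle n ha.1 ha.2.1 ha.2.2 hb
    have hcT : c ∉ T := fun h => by
      have := (hT2 c h).2.1
      have := hc.1
      linarith
    have haS : a ∉ S := fun h => lt_irrefl _ (hmax a h)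
    refine ⟨insert c T, ?_, ?_⟩
    · rw [Finset.card_insert_of_notMem hcT, Finset.card_insert_of_notMem haS, hT]
    · intro y hy
      rcases Finset.mem_insert.1 hy with rfl | hy
      · exact ⟨ha.1.trans hc.1, hc.2, hc0⟩
      · have := hT2 y hy
        exact ⟨this.1, this.2.1.trans ha.2.1, this.2.2⟩

/-- If `J_n` does not vanish at a point then the ratio satisfies a Riccati equation. -/
lemma riccati (n : ℕ) {t : ℝ} (ht : 0 < t) (h : besselJ n t ≠ 0) :
    HasDerivAt (fun t => besselJ (n + 1) t / besselJ n t)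
      (1 + (besselJ (n + 1) t / besselJ n t) ^ 2 -
        (2 * n + 1) / t * (besselJ (n + 1) t / besselJ n t)) t := by
  have := (bJ_deriv_succ n ht).fun_div (bJ_deriv n ht) h
  refine this.congr_deriv ?_
  field_simp
  ring

lemma length_bound (n : ℕ) {a b c : ℝ} (ha : 0 < a) (hab : a ≤ b)
    (h : ∀ t ∈ Set.Icc a b, besselJ n t ≠ 0)
    (hc : ∀ t ∈ Set.Icc a b, c * (1 + (besselJ (n + 1) t / besselJ n t) ^ 2) ≤
      1 + (besselJ (n + 1) t / besselJ n t) ^ 2 -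
        (2 * n + 1) / t * (besselJ (n + 1) t / besselJ n t)) :
    c * (b - a) ≤ π := by
  let F : ℝ → ℝ := fun t => Real.arctan (besselJ (n + 1) t / besselJ n t)
  have hF : ∀ t ∈ Set.Icc a b, HasDerivAt F _ t := fun t ht =>
    (riccati n (lt_of_lt_of_le ha ht.1) (h t ht)).arctan
  have := Convex.mul_sub_le_image_sub_of_le_deriv (convex_Icc a b) (f := F) (C := c)
    (fun t ht => (hF t ht).continuousAt.continuousWithinAt)
    (fun t ht => (hF t (interior_subset ht)).differentiableAt.differentiableWithinAt)
    (fun t ht => by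
      have ht := interior_subset ht
      rw [(hF t ht).deriv, one_div_mul_eq_div, le_div_iff₀ (by positivity)]
      exact hc t ht) a ⟨le_rfl, hab⟩ b ⟨hab, le_rfl⟩ hab
  have h1 := Real.arctan_lt_pi_div_two (besselJ (n + 1) b / besselJ n b)
  have h2 := Real.neg_pi_div_two_lt_arctan (besselJ (n + 1) a / besselJ n a)
  simp only [F] at this
  linarith

lemma exists_zero (n : ℕ) {a : ℝ} (ha : 4 * n + 2 ≤ a) :
    ∃ z, a ≤ z ∧ z < a + 5 ∧ besselJ n z = 0 := by
  by_contra hcon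
  push Not at hcon
  have hn : (0 : ℝ) ≤ n := by positivity
  have ha0 : 0 < a := by linarith
  have := length_bound n (a := a) (b := a + 4.5) (c := 3 / 4) ha0 (by linarith)
    (fun t ht => hcon t ht.1 (by have := ht.2; linarith))
    (fun t ht => by
      have ht0 : 0 < t := lt_of_lt_of_le ha0 ht.1
      generalize besselJ (n + 1) t / besselJ n t = y
      have hq : (2 * n + 1) / t ≤ 1 / 2 := by
        rw [div_le_iff₀ ht0]; have := ht.1; linarith
      have hq0 : 0 ≤ (2 * n + 1) / t := by positivity
      generalize (2 * (n : ℝ) + 1) / t = q at *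
      have h1 : q * y ≤ q * ((1 + y ^ 2) / 2) := by
        apply mul_le_mul_of_nonneg_left _ hq0
        nlinarith [sq_nonneg (y - 1)]
      have h2 : q * ((1 + y ^ 2) / 2) ≤ 1 / 2 * ((1 + y ^ 2) / 2) := by
        apply mul_le_mul_of_nonneg_right hq (by positivity)
      linarith)
  have := Real.pi_lt_d2
  linarith

lemma zero_upper (n k : ℕ) (hk : 1 ≤ k) {a : ℝ} (ha : IsKthPosZero (besselJ n) k a) :
    a < 4 * n + 2 + 5 * k := by
  by_contra hcon
  push Not at hcon
  have hz : ∀ i : ℕ, ∃ z : ℝ, 4 * n + 2 + 5 * i ≤ z ∧ z < 4 * n + 2 + 5 * i + 5 ∧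
      besselJ n z = 0 := fun i => exists_zero n (by
        have : (0 : ℝ) ≤ i := by positivity
        linarith)
  choose z hz1 hz2 hz3 using hz
  have hmono : StrictMono z := strictMono_nat_of_lt_succ fun i => by
    have h1 := hz2 i
    have h2 := hz1 (i + 1)
    push_cast at h2
    linarith
  have hsub : ((Finset.range k).image z : Set ℝ) ⊆ {y : ℝ | 0 < y ∧ y < a ∧ besselJ n y = 0} := by
    intro y hy
    simp only [Finset.coe_image, Set.mem_image, Finset.coe_range, Set.mem_Iio] at hy
    obtain ⟨i, hi, rfl⟩ := hy
    have h1 := hz1 i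
    have h2 := hz2 i
    have h3 : (i : ℝ) + 1 ≤ k := by exact_mod_cast hi
    have hn : (0 : ℝ) ≤ n := by positivity
    have hi' : (0 : ℝ) ≤ i := by positivity
    exact ⟨by linarith, by linarith, hz3 i⟩
  have := Set.ncard_le_ncard hsub (bJ_finite n a)
  rw [Set.ncard_coe_finset, Finset.card_image_of_injective _ hmono.injective, Finset.card_range,
    ha.2.2] at this
  omega

lemma no_zero_between (n k : ℕ) {a b : ℝ} (ha : IsKthPosZero (besselJ (n + 1)) k a)
    (hb : IsKthPosZero (besselJ n) k b) (hab : b < a) {x : ℝ} (hbx : b < x) (hxa : x ≤ a) :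
    besselJ n x ≠ 0 := by
  intro hx
  obtain ⟨c, hc, hc0⟩ := bJ_rolle n hb.1 hbx hb.2.1 hx
  have hfin := bJ_finite n b
  obtain ⟨T, hT, hT2⟩ := bJ_count n hfin.toFinset b (fun y hy => by simpa using hy) hb.2.1
  rw [← Set.ncard_eq_toFinset_card _ hfin, hb.2.2] at hT
  have hcT : c ∉ T := fun h => by
    have := (hT2 c h).2.1
    have := hc.1
    linarith
  have hsub : ((insert c T : Finset ℝ) : Set ℝ) ⊆
      {y : ℝ | 0 < y ∧ y < a ∧ besselJ (n + 1) y = 0} := by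
    intro y hy
    rcases Finset.mem_insert.1 (Finset.mem_coe.1 hy) with rfl | hy
    · exact ⟨hb.1.trans hc.1, hc.2.trans_le hxa, hc0⟩
    · have := hT2 y hy
      exact ⟨this.1, this.2.1.trans hab, this.2.2⟩
  have := Set.ncard_le_ncard hsub (bJ_finite (n + 1) a)
  rw [Set.ncard_coe_finset, Finset.card_insert_of_notMem hcT, hT, ha.2.2] at this
  omega

lemma powJ_deriv (n : ℕ) {s : ℝ} (hs : 0 < s) :
    HasDerivAt (fun s => s ^ (n + 1) * besselJ (n + 1) s) (s ^ (n + 1) * besselJ n s) s := by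
  have := (hasDerivAt_pow (n + 1) s).fun_mul (bJ_deriv_succ n hs)
  refine this.congr_deriv ?_
  rw [Nat.add_sub_cancel]
  push_cast
  field_simp
  ring

/-- Key estimate. -/
lemma key_bound (n : ℕ) (hn : 1 ≤ n) {a t : ℝ} (hnt : (n : ℝ) ≤ t) (hta : t < a)
    (ha : besselJ (n + 1) a = 0) (hne : ∀ s ∈ Set.Icc t a, besselJ n s ≠ 0) :
    |besselJ (n + 1) t| ≤ Real.exp (2 * π) * (a - t) * |besselJ n a| := by
  have hn1 : (1 : ℝ) ≤ n := by exact_mod_cast hn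
  have ht0 : 0 < t := by linarith
  have ha0 : 0 < a := ht0.trans hta
  have hsign : ∀ s ∈ Set.Icc t a, besselJ (n + 1) s * besselJ n s ≤ 0 := by
    intro s hs
    rcases hs.2.lt_or_eq with hsa | hsa
    · have hs0 : 0 < s := lt_of_lt_of_le ht0 hs.1
      obtain ⟨c, hc, hc2⟩ := exists_hasDerivAt_eq_slope
        (fun s => s ^ (n + 1) * besselJ (n + 1) s) (fun s => s ^ (n + 1) * besselJ n s) hsa
        (fun x hx => (powJ_deriv n (hs0.trans_le hx.1)).continuousAt.continuousWithinAt)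
        (fun x hx => powJ_deriv n (hs0.trans hx.1))
      have hc0 : 0 < c := hs0.trans hc.1
      have hss := same_sign (bJ_continuous n) hne (x := c) (y := s)
        ⟨hs.1.trans hc.1.le, hc.2.le⟩ hs
      simp only [ha, mul_zero, zero_sub] at hc2
      rw [eq_div_iff (by linarith)] at hc2
      have h1 : 0 < c ^ (n + 1) * (a - s) * (besselJ n c * besselJ n s) :=
        mul_pos (mul_pos (by positivity) (by linarith)) hss
      have h2 : c ^ (n + 1) * (a - s) * (besselJ n c * besselJ n s) =
          - (s ^ (n + 1) * (besselJ (n + 1) s * besselJ n s)) := by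
        linear_combination (besselJ n s) * hc2
      have h3 : 0 < s ^ (n + 1) := by positivity
      by_contra hcon
      push Not at hcon
      have := mul_pos h3 hcon
      linarith
    · rw [hsa, ha, zero_mul]
  have hmono : MonotoneOn (fun s => besselJ n s ^ 2) (Set.Icc t a) := by
    apply monotoneOn_of_deriv_nonneg (convex_Icc _ _)
    · exact ((bJ_continuous n).pow 2).continuousOn
    · intro s hs
      have hs0 : 0 < s := lt_of_lt_of_le ht0 (interior_subset hs).1
      exact ((bJ_deriv n hs0).fun_pow 2).differentiableAt.differentiableWithinAt
    · intro s hs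
      have hs := interior_subset hs
      have hs0 : 0 < s := lt_of_lt_of_le ht0 hs.1
      rw [((bJ_deriv n hs0).fun_pow 2).deriv]
      have h1 := hsign s hs
      have h2 : 0 ≤ n / s * besselJ n s ^ 2 := by positivity
      norm_num
      nlinarith
  have habs : ∀ s ∈ Set.Icc t a, |besselJ n s| ≤ |besselJ n a| := fun s hs =>
    sq_le_sq.1 (hmono hs ⟨hta.le, le_rfl⟩ hs.2)
  have hmvt := Convex.norm_image_sub_le_of_norm_hasDerivWithin_le
    (f := fun s => s ^ (n + 1) * besselJ (n + 1) s) (f' := fun s => s ^ (n + 1) * besselJ n s)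
    (s := Set.Icc t a) (C := a ^ (n + 1) * |besselJ n a|) (x := a) (y := t)
    (fun s hs => (powJ_deriv n (ht0.trans_le hs.1)).hasDerivWithinAt)
    (fun s hs => by
      have hs0 : 0 < s := lt_of_lt_of_le ht0 hs.1
      rw [Real.norm_eq_abs, abs_mul, abs_of_pos (show 0 < s ^ (n + 1) by positivity)]
      have := habs s hs
      have := hs.2
      gcongr)
    (convex_Icc _ _) ⟨hta.le, le_rfl⟩ ⟨le_rfl, hta.le⟩
  simp only [ha, mul_zero, sub_zero, Real.norm_eq_abs] at hmvt
  rw [abs_mul, abs_of_pos (show 0 < t ^ (n + 1) by positivity), abs_sub_comm,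
    abs_of_pos (show 0 < a - t by linarith)] at hmvt
  -- length
  have hlen : 1 * (a - t) ≤ π := by
    refine length_bound n ht0 hta.le hne ?_
    intro s hs
    have hs0 : 0 < s := lt_of_lt_of_le ht0 hs.1
    have h1 : besselJ (n + 1) s / besselJ n s ≤ 0 := by
      have : besselJ (n + 1) s / besselJ n s =
          besselJ (n + 1) s * besselJ n s / besselJ n s ^ 2 := by
        have := hne s hs
        field_simp
      rw [this]
      exact div_nonpos_of_nonpos_of_nonneg (hsign s hs) (sq_nonneg _)
    have h2 : 0 ≤ (2 * (n : ℝ) + 1) / s := by positivity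
    have := mul_nonpos_of_nonneg_of_nonpos h2 h1
    linarith
  have hpow : a ^ (n + 1) ≤ Real.exp (2 * π) * t ^ (n + 1) := by
    have h1 : a ≤ t * Real.exp (π / t) := by
      have h := Real.add_one_le_exp (π / t)
      have : t * (π / t + 1) = π + t := by field_simp
      have := mul_le_mul_of_nonneg_left h ht0.le
      linarith
    calc a ^ (n + 1) ≤ (t * Real.exp (π / t)) ^ (n + 1) := by gcongr
      _ = Real.exp ((n + 1 : ℕ) * (π / t)) * t ^ (n + 1) := by
        rw [mul_pow, ← Real.exp_nat_mul]; ring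
      _ ≤ Real.exp (2 * π) * t ^ (n + 1) := by
        apply mul_le_mul_of_nonneg_right _ (by positivity)
        apply Real.exp_le_exp.2
        push_cast
        rw [← mul_div_assoc, div_le_iff₀ ht0]
        have := Real.pi_pos
        nlinarith
  have hfin : t ^ (n + 1) * |besselJ (n + 1) t| ≤
      t ^ (n + 1) * (Real.exp (2 * π) * (a - t) * |besselJ n a|) := by
    refine hmvt.trans ?_
    have : 0 ≤ |besselJ n a| * (a - t) := mul_nonneg (abs_nonneg _) (by linarith)
    have := mul_le_mul_of_nonneg_right hpow this
    linarith
  exact le_of_mul_le_mul_left hfin (by positivity)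

/-- There is a constant `C > 0` such that for all `n ≥ 1` and `1 ≤ k ≤ n`, with
`a = j (n+1) k` and `b = j n k`, one has `|J_{n+1}(a x)| ≤ C n (1 - x) |J_n(a)|`
for `b/a < x < 1`. -/
theorem besselJ_succ_ratio_bound (j : ℕ → ℕ → ℝ)
    (hj : ∀ n k, 1 ≤ k → IsKthPosZero (besselJ n) k (j n k)) :
    ∃ C : ℝ, 0 < C ∧ ∀ (n k : ℕ), 1 ≤ n → 1 ≤ k → k ≤ n → ∀ x : ℝ,
      j n k / j (n + 1) k < x → x < 1 →
      |besselJ (n + 1) (j (n + 1) k * x)| ≤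
        C * n * (1 - x) * |besselJ n (j (n + 1) k)| := by
  refine ⟨15 * Real.exp (2 * π), by positivity, ?_⟩
  intro n k hn hk hkn x hx1 hx2
  have ha := hj (n + 1) k hk
  have hb := hj n k hk
  generalize j (n + 1) k = a at *
  generalize j n k = b at *
  have ha0 := ha.1
  have hb0 := hb.1
  have hbt : b < a * x := by
    rw [div_lt_iff₀ ha0] at hx1
    linarith
  have hta : a * x < a := by nlinarith
  have hnb : (n : ℝ) ≤ b := by
    by_contra hcon
    push Not at hcon
    have := bJ_pos n hn hb0 hcon.le
    rw [hb.2.1] at this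
    exact lt_irrefl _ this
  have hkey := key_bound n hn (a := a) (t := a * x) (by linarith) hta ha.2.1 (fun s hs =>
    no_zero_between n k ha hb (hbt.trans hta) (hbt.trans_le hs.1) hs.2)
  have hup := zero_upper (n + 1) k hk ha
  push_cast at hup
  have hn1 : (1 : ℝ) ≤ n := by exact_mod_cast hn
  have hk1 : (k : ℝ) ≤ n := by exact_mod_cast hkn
  have ha15 : a ≤ 15 * n := by linarith
  refine hkey.trans ?_
  have h0 : 0 ≤ Real.exp (2 * π) * (1 - x) * |besselJ n a| :=
    mul_nonneg (mul_nonneg (Real.exp_pos _).le (by linarith)) (abs_nonneg _)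
  have := mul_le_mul_of_nonneg_right ha15 h0
  linarith
end

section
/- For all integers n ≥ 0 and k ≥ 1, set α = j_{n+1,k}. If 0 ≤ δ ≤ 1/α, then ∫_{1−δ}^{1} r · J_n(αr)² dr ≤ δ · J_n(α)². (Equivalently, the vorticity ω_{nk}(r,θ) = J_n(αr)e^{inθ}/(π^{1/2}|J_n(α)|) of the corresponding Stokes eigenfunction on the unit disk, normalized to have unit L² norm, satisfies ‖ω_{nk}‖²_{L²(Γ_δ)} ≤ 2δ on the boundary layer Γ_δ = {1−δ < |x| < 1}.) -/
open Real MeasureTheory intervalIntegral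

/-- Auxiliary entire function: `J_n(x) = (x/2)^n F_n(x^2/4)`. -/
noncomputable def auxF (n : ℕ) (t : ℝ) : ℝ :=
  ∑' m : ℕ, ((-1 : ℝ) ^ m / (Nat.factorial m * Nat.factorial (m + n))) * t ^ m

lemma auxF_bound (n m : ℕ) (t R : ℝ) (ht : |t| ≤ R) :
    ‖((-1 : ℝ) ^ m / (Nat.factorial m * Nat.factorial (m + n))) * t ^ m‖
      ≤ R ^ m / Nat.factorial m := by
  have h1 : (1 : ℝ) ≤ Nat.factorial (m + n) := by exact_mod_cast Nat.factorial_pos _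
  have h0 : (0 : ℝ) < Nat.factorial m := by exact_mod_cast Nat.factorial_pos _
  have h2 : |t| ^ m ≤ R ^ m := pow_le_pow_left₀ (abs_nonneg _) ht m
  rw [norm_mul, norm_div, norm_pow, norm_pow, norm_mul]
  simp only [norm_neg, norm_one, one_pow, Real.norm_eq_abs, Nat.abs_cast]
  rw [one_div, inv_mul_eq_div]
  apply div_le_div₀ (le_trans (by positivity) h2) h2 h0
  nlinarith

lemma auxF_summable (n : ℕ) (t : ℝ) :
    Summable fun m : ℕ => ((-1 : ℝ) ^ m / (Nat.factorial m * Nat.factorial (m + n))) * t ^ m :=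
  Summable.of_norm_bounded (Real.summable_pow_div_factorial |t|)
    (fun m => auxF_bound n m t |t| le_rfl)

lemma auxF_zero (n : ℕ) : 0 < auxF n 0 := by
  unfold auxF
  rw [tsum_eq_single 0]
  · simp; positivity
  · intro m hm
    simp [hm]

lemma auxF_term_deriv (n m : ℕ) (t : ℝ) :
    ((-1 : ℝ) ^ (m + 1) / (Nat.factorial (m + 1) * Nat.factorial (m + 1 + n))) *
      (((m + 1 : ℕ) : ℝ) * t ^ m) =
    -(((-1 : ℝ) ^ m / (Nat.factorial m * Nat.factorial (m + (n + 1)))) * t ^ m) := by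
  have h0 : (Nat.factorial m : ℝ) ≠ 0 := by exact_mod_cast Nat.factorial_ne_zero _
  have h1 : (Nat.factorial (m + 1 + n) : ℝ) ≠ 0 := by exact_mod_cast Nat.factorial_ne_zero _
  have h2 : ((m : ℝ) + 1) ≠ 0 := by positivity
  rw [show m + (n + 1) = m + 1 + n by ring, Nat.factorial_succ m]
  push_cast
  field_simp
  ring

lemma auxF_hasDerivAt (n : ℕ) (t : ℝ) : HasDerivAt (auxF n) (-auxF (n + 1) t) t := by
  set g' : ℕ → ℝ → ℝ := fun m y =>
    ((-1 : ℝ) ^ m / (Nat.factorial m * Nat.factorial (m + n))) * ((m : ℝ) * y ^ (m - 1)) with hg'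
  set u : ℕ → ℝ := fun m => (|t| + 1) ^ (m - 1) / Nat.factorial (m - 1) with hu
  have hus : Summable u := by
    rw [← summable_nat_add_iff 1]
    simpa [hu] using Real.summable_pow_div_factorial (|t| + 1)
  have key := hasDerivAt_tsum_of_isPreconnected (u := u)
    (g := fun m y => ((-1 : ℝ) ^ m / (Nat.factorial m * Nat.factorial (m + n))) * y ^ m)
    (g' := g') (t := Metric.ball (0 : ℝ) (|t| + 1)) (y₀ := 0) (y := t)
    hus Metric.isOpen_ball (convex_ball _ _).isPreconnected
    (fun m y _ => (hasDerivAt_pow m y).const_mul _)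
    (by
      intro m y hy
      have hy' : |y| ≤ |t| + 1 := by
        have := mem_ball_zero_iff.1 hy
        exact this.le
      cases m with
      | zero => simp [hg', hu]
      | succ k =>
        simp only [hg', hu, Nat.add_sub_cancel]
        rw [auxF_term_deriv, norm_neg]
        exact auxF_bound (n + 1) k y _ hy')
    (Metric.mem_ball_self (by positivity)) (auxF_summable n 0)
    (by rw [mem_ball_zero_iff, Real.norm_eq_abs]; linarith)
  have e : ∑' m, g' m t = -auxF (n + 1) t := by
    have hs : Summable fun m => g' (m + 1) t := by
      have : (fun m => g' (m + 1) t) = fun m =>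
        -(((-1 : ℝ) ^ m / (Nat.factorial m * Nat.factorial (m + (n + 1)))) * t ^ m) := by
        funext m
        simp only [hg', Nat.add_sub_cancel]
        rw [auxF_term_deriv]
      rw [this]
      exact (auxF_summable (n + 1) t).neg
    have hs' : Summable fun m => g' m t := (summable_nat_add_iff (f := fun m => g' m t) 1).1 hs
    rw [hs'.tsum_eq_zero_add]
    unfold auxF
    rw [← tsum_neg]
    simp only [hg', Nat.add_sub_cancel, auxF_term_deriv]
    simp
  rw [e] at key
  exact key

lemma auxF_rec (n : ℕ) (t : ℝ) :
    auxF n t = (n + 1) * auxF (n + 1) t - t * auxF (n + 2) t := by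
  have h0 := (auxF_summable n t).tsum_eq_zero_add
  have h1 := (auxF_summable (n + 1) t).tsum_eq_zero_add
  have s1 := (summable_nat_add_iff 1).2 (auxF_summable (n + 1) t)
  have s2 := auxF_summable (n + 2) t
  unfold auxF
  rw [h0, h1, mul_add, add_sub_assoc, ← tsum_mul_left, ← tsum_mul_left,
    ← (s1.mul_left _).tsum_sub (s2.mul_left _)]
  congr 1
  · have : (Nat.factorial n : ℝ) ≠ 0 := by exact_mod_cast Nat.factorial_ne_zero _
    have h2 : ((n : ℝ) + 1) ≠ 0 := by positivity
    simp [Nat.factorial_succ]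
    field_simp
  · congr 1
    funext m
    have h0 : (Nat.factorial m : ℝ) ≠ 0 := by exact_mod_cast Nat.factorial_ne_zero _
    have h1 : (Nat.factorial (m + n + 1) : ℝ) ≠ 0 := by exact_mod_cast Nat.factorial_ne_zero _
    have h2 : ((m : ℝ) + 1) ≠ 0 := by positivity
    have h3 : ((m : ℝ) + n + 1 + 1) ≠ 0 := by positivity
    rw [show m + 1 + n = m + n + 1 by ring, show m + 1 + (n + 1) = m + n + 1 + 1 by ring,
      show m + (n + 2) = m + n + 1 + 1 by ring, Nat.factorial_succ m,
      Nat.factorial_succ (m + n + 1)]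
    push_cast
    field_simp
    ring

/-- `G_n(x) = F_n(x^2/4)`. -/
noncomputable def auxG (n : ℕ) (x : ℝ) : ℝ := auxF n (x ^ 2 / 4)

lemma besselJ_eq (n : ℕ) (x : ℝ) : besselJ n x = (x / 2) ^ n * auxG n x := by
  unfold besselJ auxG auxF
  rw [← tsum_mul_left]
  congr 1
  funext m
  rw [show x ^ 2 / 4 = (x / 2) ^ 2 by ring, ← pow_mul, pow_add]
  ring

lemma auxG_hasDerivAt (n : ℕ) (x : ℝ) :
    HasDerivAt (auxG n) (-(x / 2 * auxG (n + 1) x)) x := by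
  have h : HasDerivAt (fun y : ℝ => y ^ 2 / 4) (x / 2) x := by
    have := (hasDerivAt_pow 2 x).div_const 4
    refine HasDerivAt.congr_deriv this ?_
    simp; ring
  have := (auxF_hasDerivAt n (x ^ 2 / 4)).comp x h
  refine HasDerivAt.congr_deriv this ?_
  unfold auxG; ring

lemma auxH_hasDerivAt (n : ℕ) (x : ℝ) :
    HasDerivAt (fun y => y / 2 * auxG (n + 1) y) (auxG n x - (n + 1 / 2) * auxG (n + 1) x) x := by
  have := ((hasDerivAt_id x).div_const 2).mul (auxG_hasDerivAt (n + 1) x)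
  refine HasDerivAt.congr_deriv this ?_
  have r := auxF_rec n (x ^ 2 / 4)
  change auxG n x = _ * auxG (n + 1) x - _ * auxG (n + 2) x at r
  rw [r]
  simp only [id]
  ring

lemma auxW_hasDerivAt (n : ℕ) (g q : ℝ → ℝ) (x : ℝ)
    (hq : HasDerivAt (fun y => y / 2 * q y) (g x - (n + 1 / 2) * q x) x) :
    HasDerivAt (fun y => y ^ (2 * n + 1) * (y / 2 * q y)) (x ^ (2 * n + 1) * g x) x := by
  have := (hasDerivAt_pow (2 * n + 1) x).mul hq
  refine HasDerivAt.congr_deriv this ?_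
  simp only [Nat.add_sub_cancel]
  push_cast
  ring

lemma auxD_hasDerivAt (n : ℕ) (g q : ℝ → ℝ) (x : ℝ)
    (hg : HasDerivAt g (-(x / 2 * q x)) x)
    (hq : HasDerivAt (fun y => y / 2 * q y) (g x - (n + 1 / 2) * q x) x) :
    HasDerivAt (fun y => rexp y * (g y - y / 2 * q y)) (rexp x * ((n + 1 / 2 - x) * q x)) x := by
  have := (Real.hasDerivAt_exp x).mul (hg.sub hq)
  refine HasDerivAt.congr_deriv this ?_
  simp only [Pi.sub_apply]
  ring

lemma mono_of_deriv (f f' : ℝ → ℝ) (a b : ℝ) (hab : a ≤ b) (hf : ∀ x, HasDerivAt f (f' x) x)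
    (h : ∀ x, a < x → x < b → 0 ≤ f' x) : f a ≤ f b := by
  have : MonotoneOn f (Set.Icc a b) := by
    apply monotoneOn_of_deriv_nonneg (convex_Icc a b)
      (fun x _ => (hf x).continuousAt.continuousWithinAt)
      (fun x _ => (hf x).differentiableAt.differentiableWithinAt)
    intro x hx
    rw [interior_Icc] at hx
    rw [(hf x).deriv]
    exact h x hx.1 hx.2
  exact this (Set.left_mem_Icc.2 hab) (Set.right_mem_Icc.2 hab) hab

lemma auxG_continuous (n : ℕ) : Continuous (auxG n) :=
  continuous_iff_continuousAt.2 fun x => (auxG_hasDerivAt n x).continuousAt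

/-- No zeros up to `n + 1/2`. -/
lemma auxG_pos (n : ℕ) (x : ℝ) (hx : 0 ≤ x) (hxn : x ≤ n + 1 / 2) : 0 < auxG n x := by
  by_contra! hneg
  have h00 : 0 < auxG n 0 := by
    have := auxF_zero n
    unfold auxG
    simpa using this
  have hK : IsCompact (Set.Icc 0 x ∩ {y | auxG n y ≤ 0}) :=
    isCompact_Icc.inter_right (isClosed_le (auxG_continuous n) continuous_const)
  obtain ⟨b, ⟨⟨hb0, hbx⟩, hbg⟩, hbl⟩ := hK.exists_isLeast ⟨x, ⟨hx, le_rfl⟩, hneg⟩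
  have hbg' : auxG n b ≤ 0 := hbg
  have hpos : ∀ y, 0 ≤ y → y < b → 0 < auxG n y := by
    intro y hy hyb
    by_contra! hc
    exact absurd (hbl ⟨⟨hy, hyb.le.trans hbx⟩, hc⟩) (not_le.2 hyb)
  have hq : ∀ y, 0 < y → y ≤ b → 0 ≤ auxG (n + 1) y := by
    intro y hy hyb
    have := mono_of_deriv _ _ 0 y hy.le
      (fun z => auxW_hasDerivAt n (auxG n) (auxG (n + 1)) z (auxH_hasDerivAt n z))
      (fun z hz hzy => mul_nonneg (by positivity) (hpos z hz.le (hzy.trans_le hyb)).le)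
    simp only [zero_div, zero_mul, mul_zero] at this
    have h3 : 0 < y ^ (2 * n + 1) * (y / 2) := by positivity
    rw [← mul_assoc] at this
    exact nonneg_of_mul_nonneg_right this h3
  have hD := mono_of_deriv _ _ 0 b hb0
      (fun z => auxD_hasDerivAt n (auxG n) (auxG (n + 1)) z (auxG_hasDerivAt n z)
        (auxH_hasDerivAt n z))
      (fun z hz hzb => mul_nonneg (Real.exp_pos _).le
        (mul_nonneg (by linarith) (hq z hz hzb.le)))
  simp only [zero_div, zero_mul, Real.exp_zero, one_mul, sub_zero] at hD
  rcases hb0.eq_or_lt with rfl | hb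
  · linarith
  have := hq b hb le_rfl
  have h1 : auxG n b - b / 2 * auxG (n + 1) b ≤ 0 := by nlinarith
  have := mul_nonpos_of_nonneg_of_nonpos (Real.exp_pos b).le h1
  linarith

lemma boundary_pos (n : ℕ) (g q : ℝ → ℝ) (α : ℝ)
    (hg : ∀ x, HasDerivAt g (-(x / 2 * q x)) x)
    (hq : ∀ x, HasDerivAt (fun y => y / 2 * q y) (g x - (n + 1 / 2) * q x) x)
    (hα : n + 3 / 2 ≤ α) (hgα : 0 < g α) (hqα : q α = 0) (x : ℝ) (hx : α - 1 < x) (hxα : x ≤ α) :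
    0 < g x ∧ g x ≤ g α := by
  have hn : (0 : ℝ) ≤ n := Nat.cast_nonneg n
  have hqle : ∀ b, α - 1 < b → (∀ y, b < y → y ≤ α → 0 < g y) →
      ∀ y, b ≤ y → y ≤ α → q y ≤ 0 := by
    intro b hb hpos y hby hyα
    have hy : 0 < y := by linarith
    have := mono_of_deriv _ _ y α hyα (fun z => auxW_hasDerivAt n g q z (hq z))
      (fun z hz hzy => mul_nonneg (pow_nonneg (by linarith) _)
        (hpos z (by linarith) hzy.le).le)
    simp only [hqα, mul_zero] at this
    have h3 : 0 < y ^ (2 * n + 1) * (y / 2) := by positivity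
    rw [← mul_assoc] at this
    by_contra! hc
    exact absurd this (not_le.2 (mul_pos h3 hc))
  have hpos : ∀ x, α - 1 < x → x ≤ α → 0 < g x := by
    intro x hx hxα
    by_contra! hneg
    have hgc : Continuous g := continuous_iff_continuousAt.2 fun x => (hg x).continuousAt
    have hK : IsCompact (Set.Icc x α ∩ {y | g y ≤ 0}) :=
      isCompact_Icc.inter_right (isClosed_le hgc continuous_const)
    obtain ⟨b, ⟨⟨hbx, hbα⟩, hbg⟩, hbl⟩ := hK.exists_isGreatest ⟨x, ⟨le_rfl, hxα⟩, hneg⟩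
    have hbg' : g b ≤ 0 := hbg
    have hposb : ∀ y, b < y → y ≤ α → 0 < g y := by
      intro y hby hyα
      by_contra! hc
      exact absurd (hbl ⟨⟨hbx.trans hby.le, hyα⟩, hc⟩) (not_le.2 hby)
    have hqb := hqle b (by linarith) hposb
    have hS : ∀ y, b ≤ y → y ≤ α → rexp y * (g y - y / 2 * q y) ≤ rexp α * g α := by
      intro y hby hyα
      have := mono_of_deriv _ _ y α hyα
        (fun z => auxD_hasDerivAt n g q z (hg z) (hq z))
        (fun z hz hzb => mul_nonneg (Real.exp_pos _).le
          (mul_nonneg_of_nonpos_of_nonpos (by linarith) (hqb z (by linarith) hzb.le)))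
      simpa [hqα] using this
    have hfin := mono_of_deriv (fun y => rexp α * g α * y - rexp y * g y)
      (fun y => rexp α * g α - rexp y * (g y - y / 2 * q y)) b α hbα
      (fun z => by
        have := ((hasDerivAt_id z).const_mul (rexp α * g α)).sub
          ((Real.hasDerivAt_exp z).mul (hg z))
        refine HasDerivAt.congr_deriv this ?_
        ring)
      (fun z hz hzα => sub_nonneg.2 (hS z hz.le hzα.le))
    have h1 : rexp b * g b ≤ 0 := mul_nonpos_of_nonneg_of_nonpos (Real.exp_pos b).le hbg'
    have h2 : 0 < rexp α * g α := mul_pos (Real.exp_pos _) hgα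
    nlinarith
  refine ⟨hpos x hx hxα, ?_⟩
  have hqx := hqle x hx (fun y hy => hpos y (hx.trans hy))
  refine mono_of_deriv g _ x α hxα hg (fun z hz hzα => ?_)
  have := hqx z hz.le hzα.le
  have : z / 2 * q z ≤ 0 := mul_nonpos_of_nonneg_of_nonpos (by linarith) this
  linarith

lemma auxG_ne_zero (n : ℕ) (α : ℝ) (hα : 0 < α) (h1 : auxG (n + 1) α = 0) : auxG n α ≠ 0 := by
  intro h0
  have hall : ∀ m, auxG (n + m) α = 0 ∧ auxG (n + m + 1) α = 0 := by
    intro m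
    induction m with
    | zero => exact ⟨h0, h1⟩
    | succ m ih =>
      refine ⟨ih.2, ?_⟩
      have r := auxF_rec (n + m) (α ^ 2 / 4)
      change auxG (n + m) α = _ * auxG (n + m + 1) α - _ * auxG (n + m + 2) α at r
      rw [ih.1, ih.2] at r
      have : α ^ 2 / 4 * auxG (n + m + 2) α = 0 := by linarith
      exact (mul_eq_zero.1 this).resolve_left (by positivity)
  obtain ⟨m, hm⟩ := exists_nat_ge α
  have := auxG_pos (n + m) α hα.le (by
    push_cast
    have : (0 : ℝ) ≤ n := Nat.cast_nonneg n
    linarith)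
  linarith [(hall m).1]

lemma auxG_sq_bound (n : ℕ) (α : ℝ) (hα0 : 0 < α) (hz : auxG (n + 1) α = 0) :
    n + 3 / 2 ≤ α ∧ ∀ x, α - 1 < x → x ≤ α → auxG n x ^ 2 ≤ auxG n α ^ 2 := by
  have hα : (n : ℝ) + 3 / 2 ≤ α := by
    by_contra! hc
    have := auxG_pos (n + 1) α hα0.le (by push_cast; linarith)
    linarith
  refine ⟨hα, fun x hx hxα => ?_⟩
  rcases lt_or_gt_of_ne (auxG_ne_zero n α hα0 hz) with h | h
  · obtain ⟨h1, h2⟩ := boundary_pos n (fun y => -auxG n y) (fun y => -auxG (n + 1) y) α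
      (fun y => by
        have := (auxG_hasDerivAt n y).neg
        refine HasDerivAt.congr_deriv this ?_
        ring)
      (fun y => by
        have := (auxH_hasDerivAt n y).neg
        refine (this.congr_of_eventuallyEq (Filter.Eventually.of_forall fun z => ?_)).congr_deriv ?_
        · simp
        · ring) hα (by simpa using h) (by simpa using hz) x hx hxα
    nlinarith
  · obtain ⟨h1, h2⟩ := boundary_pos n (auxG n) (auxG (n + 1)) α (auxG_hasDerivAt n)
      (auxH_hasDerivAt n) hα h hz x hx hxα
    nlinarith

/-- With `a = j (n+1) k`: if `0 ≤ d ≤ 1/a`, then the boundary-layer vorticity integral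
satisfies `(Integral r J_n(a r)^2 on [1-d,1]) ≤ d * J_n(a)^2`. -/
theorem vorticity_boundary_layer_bound (j : ℕ → ℕ → ℝ)
    (hj : ∀ n k, 1 ≤ k → IsKthPosZero (besselJ n) k (j n k)) :
    ∀ (n k : ℕ), 1 ≤ k → ∀ δ : ℝ, 0 ≤ δ → δ ≤ 1 / j (n + 1) k →
      (∫ r in (1 - δ)..1, r * (besselJ n (j (n + 1) k * r)) ^ 2) ≤
        δ * (besselJ n (j (n + 1) k)) ^ 2 := by
  intro n k hk δ hδ hδ1
  obtain ⟨hα0, hαz, -⟩ := hj (n + 1) k hk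
  set α := j (n + 1) k
  rw [besselJ_eq] at hαz
  have hz : auxG (n + 1) α = 0 := (mul_eq_zero.1 hαz).resolve_left (by positivity)
  obtain ⟨hα, hb⟩ := auxG_sq_bound n α hα0 hz
  have hn : (0 : ℝ) ≤ n := Nat.cast_nonneg n
  have hδα : α * δ ≤ 1 := by
    rw [le_div_iff₀ hα0] at hδ1
    linarith
  have hc : Continuous fun r : ℝ => r * (besselJ n (α * r)) ^ 2 := by
    have h := auxG_continuous n
    simp only [besselJ_eq]
    fun_prop
  have e : δ * besselJ n α ^ 2 = ∫ _r in (1 - δ)..1, besselJ n α ^ 2 := by simp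
  rw [e]
  apply intervalIntegral.integral_mono_on_of_le_Ioo (by linarith)
    (hc.intervalIntegrable _ _) (continuous_const.intervalIntegrable _ _)
  rintro r ⟨hr1, hr2⟩
  have hx1 : α - 1 < α * r := by nlinarith
  have hr0 : 0 < r := by
    by_contra! hc
    nlinarith
  have hx2 : α * r ≤ α := by nlinarith
  have hG := hb (α * r) hx1 hx2
  have hP : (α * r / 2) ^ n ≤ (α / 2) ^ n := pow_le_pow_left₀ (by positivity) (by linarith) n
  have hP2 : ((α * r / 2) ^ n) ^ 2 ≤ ((α / 2) ^ n) ^ 2 := pow_le_pow_left₀ (by positivity) hP 2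
  rw [besselJ_eq, besselJ_eq, mul_pow, mul_pow]
  calc r * (((α * r / 2) ^ n) ^ 2 * auxG n (α * r) ^ 2)
      ≤ 1 * (((α * r / 2) ^ n) ^ 2 * auxG n (α * r) ^ 2) := by gcongr
    _ ≤ _ := by rw [one_mul]; gcongr
end
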